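/- arXiv:2605.22016 — 4 statements merged into one kernel-verified Lean document; each statement's English description precedes it below -/
import Mathlib

section
/- Define the logarithmic mean g₂ : [0,∞)² → [0,∞) by g₂(t,r) = (t−r)/(log t − log r) for t,r > 0 with t ≠ r, g₂(t,t) = t for t > 0, and g₂(t,r) = 0 whenever t = 0 or r = 0. Then g₂ is concave on [0,∞)²: for all (t₁,r₁), (t₂,r₂) ∈ [0,∞)² and all λ ∈ [0,1], g₂(λt₁+(1−λ)t₂, λr₁+(1−λ)r₂) ≥ λ g₂(t₁,r₁) + (1−λ) g₂(t₂,r₂). -/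
noncomputable section

/-- The logarithmic mean (logarithmic probability weight): `g₂(t,r) = (t−r)/(log t − log r)`
for `t, r > 0` with `t ≠ r`, `g₂(t,t) = t` for `t > 0`, and `g₂(t,r) = 0` if `t = 0` or
`r = 0` (values for negative arguments are irrelevant and set to `0`). -/
def logMean (t r : ℝ) : ℝ :=
  if t ≤ 0 ∨ r ≤ 0 then 0
  else if t = r then t
  else (t - r) / (Real.log t - Real.log r)

/-- For positive arguments the weighted geometric mean is exponential in its weight. -/
theorem rpow_mul_rpow_one_sub_eq_exp {t r : ℝ} (ht : 0 < t) (hr : 0 < r) (x : ℝ) :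
    t ^ x * r ^ (1 - x) = r * Real.exp ((Real.log t - Real.log r) * x) := by
  nth_rewrite 2 [← Real.exp_log hr]
  rw [Real.rpow_def_of_pos ht, Real.rpow_def_of_pos hr, ← Real.exp_add, ← Real.exp_add]
  ring_nf

/-- The weighted geometric mean vanishes if one argument does. -/
theorem rpow_mul_rpow_one_sub_eq_zero {t r x : ℝ} (h : t = 0 ∨ r = 0)
    (hx : x ∈ Set.Ioo (0 : ℝ) 1) : t ^ x * r ^ (1 - x) = 0 := by
  rcases h with rfl | rfl
  · rw [Real.zero_rpow hx.1.ne', zero_mul]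
  · rw [Real.zero_rpow (sub_pos.2 hx.2).ne', mul_zero]

/-- The weighted geometric mean is superadditive. -/
theorem rpow_mul_rpow_one_sub_add_le {p₁ q₁ p₂ q₂ x : ℝ} (hp₁ : 0 ≤ p₁) (hq₁ : 0 ≤ q₁)
    (hp₂ : 0 ≤ p₂) (hq₂ : 0 ≤ q₂) (hx : x ∈ Set.Ioo (0 : ℝ) 1) :
    p₁ ^ x * q₁ ^ (1 - x) + p₂ ^ x * q₂ ^ (1 - x) ≤ (p₁ + p₂) ^ x * (q₁ + q₂) ^ (1 - x) := by
  have hx' : 0 < 1 - x := sub_pos.2 hx.2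
  rcases (add_nonneg hp₁ hp₂).eq_or_lt with hp | hp
  · obtain ⟨rfl, rfl⟩ : p₁ = 0 ∧ p₂ = 0 := ⟨by linarith, by linarith⟩
    simp [Real.zero_rpow hx.1.ne']
  rcases (add_nonneg hq₁ hq₂).eq_or_lt with hq | hq
  · obtain ⟨rfl, rfl⟩ : q₁ = 0 ∧ q₂ = 0 := ⟨by linarith, by linarith⟩
    simp [Real.zero_rpow hx'.ne']
  have h₁ := Real.geom_mean_le_arith_mean2_weighted hx.1.le hx'.le
    (div_nonneg hp₁ hp.le) (div_nonneg hq₁ hq.le) (by ring)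
  have h₂ := Real.geom_mean_le_arith_mean2_weighted hx.1.le hx'.le
    (div_nonneg hp₂ hp.le) (div_nonneg hq₂ hq.le) (by ring)
  rw [Real.div_rpow hp₁ hp.le, Real.div_rpow hq₁ hq.le, div_mul_div_comm] at h₁
  rw [Real.div_rpow hp₂ hp.le, Real.div_rpow hq₂ hq.le, div_mul_div_comm] at h₂
  have hsum : x * (p₁ / (p₁ + p₂)) + (1 - x) * (q₁ / (q₁ + q₂)) +
      (x * (p₂ / (p₁ + p₂)) + (1 - x) * (q₂ / (q₁ + q₂))) = 1 := by
    field_simp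
    ring
  have hpos : 0 < (p₁ + p₂) ^ x * (q₁ + q₂) ^ (1 - x) := by positivity
  rw [← div_le_one hpos, add_div]
  linarith

/-- The weighted geometric mean is homogeneous. -/
theorem mul_rpow_mul_mul_rpow_one_sub {a t r : ℝ} (ha : 0 ≤ a) (ht : 0 ≤ t) (hr : 0 ≤ r) (x : ℝ) :
    (a * t) ^ x * (a * r) ^ (1 - x) = a * (t ^ x * r ^ (1 - x)) := by
  have h : a ^ x * a ^ (1 - x) = a := by
    rw [← Real.rpow_add' ha (by simp), add_sub_cancel, Real.rpow_one]
  rw [Real.mul_rpow ha ht, Real.mul_rpow ha hr, mul_mul_mul_comm, h]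

open MeasureTheory Set in
theorem integrableOn_rpow_mul_rpow_one_sub {t r : ℝ} (ht : 0 ≤ t) (hr : 0 ≤ r) :
    IntegrableOn (fun x : ℝ ↦ t ^ x * r ^ (1 - x)) (Ioo 0 1) := by
  by_cases h : t = 0 ∨ r = 0
  · exact integrableOn_zero.congr_fun
      (fun x hx ↦ (rpow_mul_rpow_one_sub_eq_zero h hx).symm) measurableSet_Ioo
  · push Not at h
    simp_rw [rpow_mul_rpow_one_sub_eq_exp (ht.lt_of_ne' h.1) (hr.lt_of_ne' h.2)]
    exact (Continuous.integrableOn_Icc (by fun_prop)).mono_set Ioo_subset_Icc_self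

open MeasureTheory Set in
/-- The logarithmic mean is the average of the weighted geometric means. -/
theorem logMean_eq_integral {t r : ℝ} (ht : 0 ≤ t) (hr : 0 ≤ r) :
    logMean t r = ∫ x in Ioo (0 : ℝ) 1, t ^ x * r ^ (1 - x) := by
  by_cases h : t = 0 ∨ r = 0
  · rw [setIntegral_congr_fun measurableSet_Ioo
      (fun x hx ↦ rpow_mul_rpow_one_sub_eq_zero h hx), integral_zero, logMean,
      if_pos (h.imp Eq.le Eq.le)]
  · push Not at h
    have ht' := ht.lt_of_ne' h.1
    have hr' := hr.lt_of_ne' h.2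
    simp_rw [rpow_mul_rpow_one_sub_eq_exp ht' hr']
    rw [logMean, if_neg (by simp [ht', hr']), ← integral_Ioc_eq_integral_Ioo,
      ← intervalIntegral.integral_of_le zero_le_one]
    split_ifs with htr
    · simp [htr]
    · have hc : Real.log t - Real.log r ≠ 0 :=
        sub_ne_zero.2 fun h ↦ htr (Real.log_injOn_pos ht' hr' h)
      rw [intervalIntegral.integral_const_mul,
        intervalIntegral.integral_comp_mul_left (fun x ↦ Real.exp x) hc, integral_exp, mul_one,
        mul_zero, Real.exp_zero, Real.exp_sub, Real.exp_log ht', Real.exp_log hr', smul_eq_mul]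
      field_simp

/-- The logarithmic mean is concave on `[0,∞)²`: for all `(t₁,r₁), (t₂,r₂) ∈ [0,∞)²`
and `a ∈ [0,1]`,
`g₂(a t₁ + (1−a) t₂, a r₁ + (1−a) r₂) ≥ a g₂(t₁,r₁) + (1−a) g₂(t₂,r₂)`. -/
theorem logMean_concaveOn :
    ∀ t₁ r₁ t₂ r₂ a : ℝ, 0 ≤ t₁ → 0 ≤ r₁ → 0 ≤ t₂ → 0 ≤ r₂ → 0 ≤ a → a ≤ 1 →
      a * logMean t₁ r₁ + (1 - a) * logMean t₂ r₂ ≤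
        logMean (a * t₁ + (1 - a) * t₂) (a * r₁ + (1 - a) * r₂) := by
  intro t₁ r₁ t₂ r₂ a ht₁ hr₁ ht₂ hr₂ ha ha'
  have hb : 0 ≤ 1 - a := sub_nonneg.2 ha'
  have hT : 0 ≤ a * t₁ + (1 - a) * t₂ := by positivity
  have hR : 0 ≤ a * r₁ + (1 - a) * r₂ := by positivity
  have h₁ := (integrableOn_rpow_mul_rpow_one_sub ht₁ hr₁).const_mul a
  have h₂ := (integrableOn_rpow_mul_rpow_one_sub ht₂ hr₂).const_mul (1 - a)
  rw [logMean_eq_integral ht₁ hr₁, logMean_eq_integral ht₂ hr₂, logMean_eq_integral hT hR,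
    ← MeasureTheory.integral_const_mul, ← MeasureTheory.integral_const_mul,
    ← MeasureTheory.integral_add h₁ h₂]
  refine MeasureTheory.setIntegral_mono_on (h₁.add h₂)
    (integrableOn_rpow_mul_rpow_one_sub hT hR) measurableSet_Ioo fun x hx ↦ ?_
  rw [← mul_rpow_mul_mul_rpow_one_sub ha ht₁ hr₁, ← mul_rpow_mul_mul_rpow_one_sub hb ht₂ hr₂]
  exact rpow_mul_rpow_one_sub_add_le (mul_nonneg ha ht₁) (mul_nonneg ha hr₁)
    (mul_nonneg hb ht₂) (mul_nonneg hb hr₂) hx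
end
end

section
/- Fix d ≥ 2, h > 0 and a vector m ∈ ℝ^{d−1}. Let P̃ = {x ∈ ℝ^{d−1} : 0 ≤ x₁ ≤ ⋯ ≤ x_{d−1} ≤ 1}, and for f : ℝ^{d−1} → ℝ put D⁺f(x) = f(x + hm) − f(x) and D⁻f(x) = f(x) − f(x − hm). Let φ, A, B, w : ℝ^{d−1} → ℝ be bounded measurable functions such that A = 0 and B = 0 on ℝ^{d−1} ∖ P̃, and w = 0 on ℝ^{d−1} ∖ P̃. Then ∫_{P̃} φ(x) (D⁻A(x) + D⁺B(x)) w(x) dx = −∫_{P̃} (A(x) D⁺φ(x) + B(x) D⁻φ(x)) w(x) dx − ∫_{P̃} A(x) φ(x + hm) D⁺w(x) dx − ∫_{P̃} B(x) φ(x − hm) D⁻w(x) dx. -/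
open MeasureTheory

noncomputable section

/-- `P̃ = {x ∈ ℝ^{d−1} : 0 ≤ x₁ ≤ ⋯ ≤ x_{d−1} ≤ 1}`. -/
def Ptilde (d : ℕ) : Set (Fin (d - 1) → ℝ) :=
  {x | (∀ l, 0 ≤ x l ∧ x l ≤ 1) ∧ ∀ l m : Fin (d - 1), l ≤ m → x l ≤ x m}

/-- An a.e. strongly measurable function which is bounded and vanishes off a set of finite measure
is integrable. -/
theorem integrable_of_bounded_of_eq_zero_off {α : Type*} [MeasurableSpace α] {μ : Measure α}
    {s : Set α} (hs : μ s ≠ ⊤) {f : α → ℝ} (hf : AEStronglyMeasurable f μ)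
    (hb : ∃ C, ∀ x, |f x| ≤ C) (h0 : ∀ x, x ∉ s → f x = 0) : Integrable f μ := by
  obtain ⟨C, hC⟩ := hb
  have hon : IntegrableOn f s μ :=
    Measure.integrableOn_of_bounded hs hf (M := C) (Filter.Eventually.of_forall hC)
  exact hon.integrable_of_forall_notMem_eq_zero h0

theorem volume_Ptilde_ne_top (d : ℕ) : volume (Ptilde d) ≠ ⊤ := by
  have hsub : Ptilde d ⊆ Set.Icc 0 1 :=
    fun x hx => ⟨fun l => (hx.1 l).1, fun l => (hx.1 l).2⟩
  exact ((measure_mono hsub).trans_lt isCompact_Icc.measure_lt_top).ne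

/-- Discrete integration by parts on an additive group with invariant measure. -/
theorem integral_discrete_by_parts {G : Type*} [MeasurableSpace G] [AddGroup G] [MeasurableAdd G]
    {μ : Measure G} [μ.IsAddRightInvariant] {φ A B w : G → ℝ} (v : G)
    (hφm : Measurable φ) (hwm : Measurable w)
    (hφb : ∃ C, ∀ x, |φ x| ≤ C) (hwb : ∃ C, ∀ x, |w x| ≤ C)
    (hA : Integrable A μ) (hB : Integrable B μ) :
    ∫ x, φ x * ((A x - A (x - v)) + (B (x + v) - B x)) * w x ∂μ
      = -(∫ x, (A x * (φ (x + v) - φ x) + B x * (φ x - φ (x - v))) * w x ∂μ)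
        - (∫ x, A x * φ (x + v) * (w (x + v) - w x) ∂μ)
        - (∫ x, B x * φ (x - v) * (w x - w (x - v)) ∂μ) := by
  obtain ⟨Cφ, hCφ⟩ := hφb
  obtain ⟨Cw, hCw⟩ := hwb
  have hadd : Measurable fun x : G => x + v := measurable_add_const v
  have hsub : Measurable fun x : G => x - v := by
    simpa only [sub_eq_add_neg] using measurable_add_const (-v)
  have hprod : ∀ {F : G → ℝ}, Integrable F μ → ∀ {p q : G → G}, Measurable p → Measurable q →
      Integrable (fun x => F x * φ (p x) * w (q x)) μ := fun hF _ _ hp hq =>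
    (hF.mul_bdd (c := Cφ) (hφm.comp hp).aestronglyMeasurable
      (Filter.Eventually.of_forall fun x => hCφ _)).mul_bdd (c := Cw)
      (hwm.comp hq).aestronglyMeasurable (Filter.Eventually.of_forall fun x => hCw _)
  have hA₀ := hprod hA measurable_id measurable_id
  have hB₀ := hprod hB measurable_id measurable_id
  have hA₁ := hprod hA hadd measurable_id
  have hB₁ := hprod hB hsub measurable_id
  have hA₂ := hprod hA hadd hadd
  have hB₂ := hprod hB hsub hsub
  have hAs := hA₂.comp_sub_right v
  have hBs := hB₂.comp_add_right v
  have hAe := integral_sub_right_eq_self (μ := μ) (fun x => A x * φ (x + v) * w (x + v)) v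
  have hBe := integral_add_right_eq_self (μ := μ) (fun x => B x * φ (x - v) * w (x - v)) v
  simp only [id, sub_add_cancel, add_sub_cancel_right] at *
  have e₀ : ∫ x, φ x * ((A x - A (x - v)) + (B (x + v) - B x)) * w x ∂μ
      = ((∫ x, A x * φ x * w x ∂μ) - ∫ x, A (x - v) * φ x * w x ∂μ)
        + ((∫ x, B (x + v) * φ x * w x ∂μ) - ∫ x, B x * φ x * w x ∂μ) := by
    rw [← integral_sub hA₀ hAs, ← integral_sub hBs hB₀]
    refine Eq.trans ?_ (integral_add (hA₀.sub hAs) (hBs.sub hB₀))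
    exact integral_congr_ae (Filter.Eventually.of_forall fun x => by simp only; ring)
  have e₁ : ∫ x, (A x * (φ (x + v) - φ x) + B x * (φ x - φ (x - v))) * w x ∂μ
      = ((∫ x, A x * φ (x + v) * w x ∂μ) - ∫ x, A x * φ x * w x ∂μ)
        + ((∫ x, B x * φ x * w x ∂μ) - ∫ x, B x * φ (x - v) * w x ∂μ) := by
    rw [← integral_sub hA₁ hA₀, ← integral_sub hB₀ hB₁]
    refine Eq.trans ?_ (integral_add (hA₁.sub hA₀) (hB₀.sub hB₁))
    exact integral_congr_ae (Filter.Eventually.of_forall fun x => by simp only; ring)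
  simp only [mul_sub (_ * _)]
  rw [e₀, e₁, integral_sub hA₂ hA₁, integral_sub hB₁ hB₂, hAe, hBe]
  ring

/-- Weighted discrete integration-by-parts identity.  With `D⁺f(x) = f(x+hm) − f(x)` and
`D⁻f(x) = f(x) − f(x−hm)`, if `φ, A, B, w` are bounded measurable, `A = B = 0` outside `P̃`
and `w = 0` outside `P̃`, then
`∫_{P̃} φ (D⁻A + D⁺B) w = −∫_{P̃} (A D⁺φ + B D⁻φ) w − ∫_{P̃} A φ(·+hm) D⁺w − ∫_{P̃} B φ(·−hm) D⁻w`. -/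
theorem weighted_discrete_integration_by_parts (d : ℕ) (hd : 2 ≤ d)
    (ms : ℝ) (hms : 0 < ms) (m : Fin (d - 1) → ℝ)
    (φ A B w : (Fin (d - 1) → ℝ) → ℝ)
    (hφm : Measurable φ) (hAm : Measurable A) (hBm : Measurable B) (hwm : Measurable w)
    (hφb : ∃ C, ∀ x, |φ x| ≤ C) (hAb : ∃ C, ∀ x, |A x| ≤ C)
    (hBb : ∃ C, ∀ x, |B x| ≤ C) (hwb : ∃ C, ∀ x, |w x| ≤ C)
    (hA0 : ∀ x, x ∉ Ptilde d → A x = 0)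
    (hB0 : ∀ x, x ∉ Ptilde d → B x = 0)
    (hw0 : ∀ x, x ∉ Ptilde d → w x = 0) :
    ∫ x in Ptilde d,
        φ x * ((A x - A (x - ms • m)) + (B (x + ms • m) - B x)) * w x
      = -(∫ x in Ptilde d,
            (A x * (φ (x + ms • m) - φ x) + B x * (φ x - φ (x - ms • m))) * w x)
        - (∫ x in Ptilde d, A x * φ (x + ms • m) * (w (x + ms • m) - w x))
        - (∫ x in Ptilde d, B x * φ (x - ms • m) * (w x - w (x - ms • m))) := by
  have hA := integrable_of_bounded_of_eq_zero_off (volume_Ptilde_ne_top d)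
    hAm.aestronglyMeasurable hAb hA0
  have hB := integrable_of_bounded_of_eq_zero_off (volume_Ptilde_ne_top d)
    hBm.aestronglyMeasurable hBb hB0
  rw [setIntegral_eq_integral_of_forall_compl_eq_zero fun x hx => by simp [hw0 x hx],
    setIntegral_eq_integral_of_forall_compl_eq_zero fun x hx => by simp [hw0 x hx],
    setIntegral_eq_integral_of_forall_compl_eq_zero fun x hx => by simp [hA0 x hx],
    setIntegral_eq_integral_of_forall_compl_eq_zero fun x hx => by simp [hB0 x hx]]
  exact integral_discrete_by_parts (ms • m) hφm hwm hφb hwb hA hB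
end
end

section
/- Let G = (V,E,ω) be an undirected connected graph with V = {1,…,d}, d ≥ 2, and P(G) = {ξ ∈ [0,1]^d : Σᵢ ξᵢ = 1}. Fix h ∈ (0,1/d), t₀ < T, and bounded functions A_{i,j}, B_{i,j} : [t₀,T] × P(G) → ℝ with A_{i,j} ≤ 0 and B_{i,j} ≥ 0 for every (i,j) ∈ E. Suppose φ : [t₀,T] × P(G) → ℝ is continuous, continuously differentiable in t, and satisfies ∂_t φ(t,ξ) + Σ_{(i,j)∈E} (√ω_{i,j}/h) (A_{i,j}(t,ξ) D⁺_{e_{i,j}}φ(t,ξ) + B_{i,j}(t,ξ) D⁻_{e_{i,j}}φ(t,ξ)) = 0 for all (t,ξ) ∈ (t₀,T] × P(G), where the differences use the constant-extrapolation convention. Then t ↦ min_{ξ∈P(G)} φ(t,ξ) is non-decreasing and t ↦ max_{ξ∈P(G)} φ(t,ξ) is non-increasing on [t₀,T]; in particular ‖φ(t,·)‖_{L∞(P(G))} ≤ ‖φ(t₀,·)‖_{L∞(P(G))} for all t ∈ [t₀,T]. -/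
open Set

attribute [local instance] Classical.propDecidable

noncomputable section

/-- The probability simplex `P(G) = {ξ ∈ [0,1]^d : Σᵢ ξᵢ = 1}`. -/
def simplex (d : ℕ) : Set (Fin d → ℝ) :=
  {ξ | (∀ i, 0 ≤ ξ i ∧ ξ i ≤ 1) ∧ ∑ i, ξ i = 1}

/-- The vector `e_{i,j} ∈ ℝ^d` with `+1` in entry `i`, `−1` in entry `j`, `0` elsewhere. -/
def eVec (d : ℕ) (i j : Fin d) : Fin d → ℝ :=
  fun k => (if k = i then (1:ℝ) else 0) - (if k = j then (1:ℝ) else 0)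

/-- Forward difference with the constant-extrapolation convention. -/
def Dplus (d : ℕ) (ms : ℝ) (i j : Fin d) (u : (Fin d → ℝ) → ℝ) (ξ : Fin d → ℝ) : ℝ :=
  if ξ + ms • eVec d i j ∈ simplex d then u (ξ + ms • eVec d i j) - u ξ else 0

/-- Backward difference with the constant-extrapolation convention. -/
def Dminus (d : ℕ) (ms : ℝ) (i j : Fin d) (u : (Fin d → ℝ) → ℝ) (ξ : Fin d → ℝ) : ℝ :=
  if ξ - ms • eVec d i j ∈ simplex d then u ξ - u (ξ - ms • eVec d i j) else 0

/-- If the time derivative of `f` is nonnegative at every spatial minimum over the compact set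
`K`, then a lower bound of `f` at the initial time persists. -/
theorem le_of_deriv_nonneg_at_spatial_min {X : Type*} [TopologicalSpace X] {K : Set X}
    (hK : IsCompact K) {s T c : ℝ} {f f' : ℝ → X → ℝ}
    (hf : ContinuousOn (fun z : ℝ × X => f z.1 z.2) (Icc s T ×ˢ K))
    (hderiv : ∀ t ∈ Ioc s T, ∀ x ∈ K, HasDerivAt (fun r => f r x) (f' t x) t)
    (hmin : ∀ t ∈ Ioc s T, ∀ x ∈ K, IsMinOn (f t) K x → 0 ≤ f' t x)
    (hc : ∀ x ∈ K, c ≤ f s x) {t : ℝ} (ht : t ∈ Icc s T) {x : X} (hx : x ∈ K) :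
    c ≤ f t x := by
  have hpert : ∀ ε : ℝ, 0 < ε → c ≤ f t x + ε * (t - s) := by
    intro ε hε
    obtain ⟨⟨r, y⟩, ⟨hr, hy⟩, hry⟩ := (isCompact_Icc.prod hK).exists_isMinOn
      ⟨(t, x), ht, hx⟩
      (hf.add (by fun_prop : ContinuousOn (fun z : ℝ × X => ε * (z.1 - s)) (Icc s T ×ˢ K)))
    have hle : ∀ r' ∈ Icc s T, ∀ y' ∈ K,
        f r y + ε * (r - s) ≤ f r' y' + ε * (r' - s) := fun r' hr' y' hy' =>
      hry (show (r', y') ∈ Icc s T ×ˢ K from ⟨hr', hy'⟩)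
    rcases hr.1.eq_or_lt with rfl | hsr
    · have h := hle t ht x hx
      have h' := hc y hy
      simp only [sub_self, mul_zero, add_zero] at h
      exact h'.trans h
    · exfalso
      have hr' : r ∈ Ioc s T := ⟨hsr, hr.2⟩
      have hnonneg : 0 ≤ f' r y := hmin r hr' y hy fun y' hy' => by
        have := hle r hr y' hy'
        simpa using this
      have hd : HasDerivAt (fun r' => f r' y + ε * (r' - s)) (f' r y + ε * 1) r :=
        (hderiv r hr' y hy).add (((hasDerivAt_id r).sub_const s).const_mul ε)
      have hslope := (hasDerivWithinAt_iff_tendsto_slope' self_notMem_Iio).1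
        (hd.hasDerivWithinAt (s := Iio r))
      have hpos : 0 < f' r y + ε * 1 := by linarith
      obtain ⟨q, hq, hqs⟩ := ((hslope.eventually_const_lt hpos).and
        (Ioo_mem_nhdsLT hsr)).exists
      rw [slope_def_field] at hq
      have hq' := hle q ⟨hqs.1.le, hqs.2.le.trans hr.2⟩ y hy
      exact hq.not_ge (div_nonpos_of_nonneg_of_nonpos (by linarith) (by linarith [hqs.2]))
  have hlim : Filter.Tendsto (fun ε : ℝ => f t x + ε * (t - s)) (nhdsWithin 0 (Ioi 0))
      (nhds (f t x + 0 * (t - s))) :=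
    (Continuous.tendsto (by fun_prop) _).mono_left nhdsWithin_le_nhds
  have := ge_of_tendsto hlim (Filter.eventually_of_mem self_mem_nhdsWithin hpert)
  simpa using this

theorem isCompact_simplex (d : ℕ) : IsCompact (simplex d) := by
  have h : simplex d = Icc 0 1 ∩ {ξ | ∑ i, ξ i = 1} := by
    ext ξ
    simp [simplex, Pi.le_def, forall_and]
  rw [h]
  exact isCompact_Icc.inter_right (isClosed_eq (by fun_prop) continuous_const)

theorem simplex_nonempty {d : ℕ} (hd : 0 < d) : (simplex d).Nonempty := by
  refine ⟨Pi.single ⟨0, hd⟩ 1, fun i => ?_, by simp⟩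
  by_cases h : i = ⟨0, hd⟩ <;> simp [h]

theorem Dplus_neg (d : ℕ) (ms : ℝ) (i j : Fin d) (u : (Fin d → ℝ) → ℝ) (ξ : Fin d → ℝ) :
    Dplus d ms i j (fun η => -u η) ξ = -Dplus d ms i j u ξ := by
  unfold Dplus
  split_ifs <;> ring

theorem Dminus_neg (d : ℕ) (ms : ℝ) (i j : Fin d) (u : (Fin d → ℝ) → ℝ) (ξ : Fin d → ℝ) :
    Dminus d ms i j (fun η => -u η) ξ = -Dminus d ms i j u ξ := by
  unfold Dminus
  split_ifs <;> ring

theorem Dplus_nonneg_of_isMinOn {d : ℕ} {u : (Fin d → ℝ) → ℝ} {ξ : Fin d → ℝ}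
    (h : IsMinOn u (simplex d) ξ) (ms : ℝ) (i j : Fin d) : 0 ≤ Dplus d ms i j u ξ := by
  unfold Dplus
  split_ifs with hξ
  · exact sub_nonneg.2 (h hξ)
  · exact le_rfl

theorem Dminus_nonpos_of_isMinOn {d : ℕ} {u : (Fin d → ℝ) → ℝ} {ξ : Fin d → ℝ}
    (h : IsMinOn u (simplex d) ξ) (ms : ℝ) (i j : Fin d) : Dminus d ms i j u ξ ≤ 0 := by
  unfold Dminus
  split_ifs with hξ
  · exact sub_nonpos.2 (h hξ)
  · exact le_rfl

/-- A lower bound at time `s` for a solution of the monotone semi-discrete transport equation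
persists at later times. -/
theorem le_of_monotone_scheme {d : ℕ} {ω : Fin d → Fin d → ℝ} {E : Finset (Fin d × Fin d)}
    {ms s T c : ℝ} (hms : 0 ≤ ms) {A B : Fin d → Fin d → ℝ → (Fin d → ℝ) → ℝ}
    (hsign : ∀ p ∈ E, ∀ t ∈ Icc s T, ∀ ξ ∈ simplex d,
      A p.1 p.2 t ξ ≤ 0 ∧ 0 ≤ B p.1 p.2 t ξ)
    {φ : ℝ → (Fin d → ℝ) → ℝ}
    (hφ : ContinuousOn (fun z : ℝ × (Fin d → ℝ) => φ z.1 z.2) (Icc s T ×ˢ simplex d))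
    (hPDE : ∀ t ∈ Ioc s T, ∀ ξ ∈ simplex d,
      HasDerivAt (fun r => φ r ξ)
        (-(∑ p ∈ E, (Real.sqrt (ω p.1 p.2) / ms) *
            (A p.1 p.2 t ξ * Dplus d ms p.1 p.2 (φ t) ξ +
             B p.1 p.2 t ξ * Dminus d ms p.1 p.2 (φ t) ξ))) t)
    (hc : ∀ ξ ∈ simplex d, c ≤ φ s ξ) {t : ℝ} (ht : t ∈ Icc s T) {ξ : Fin d → ℝ}
    (hξ : ξ ∈ simplex d) : c ≤ φ t ξ := by
  refine le_of_deriv_nonneg_at_spatial_min (isCompact_simplex d) hφ hPDE ?_ hc ht hξ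
  intro t ht ξ hξ hmin
  refine neg_nonneg.2 (Finset.sum_nonpos fun p hp => ?_)
  obtain ⟨hA, hB⟩ := hsign p hp t (Ioc_subset_Icc_self ht) ξ hξ
  exact mul_nonpos_of_nonneg_of_nonpos (by positivity) (add_nonpos
    (mul_nonpos_of_nonpos_of_nonneg hA (Dplus_nonneg_of_isMinOn hmin ms p.1 p.2))
    (mul_nonpos_of_nonneg_of_nonpos hB (Dminus_nonpos_of_isMinOn hmin ms p.1 p.2)))

/-- Discrete maximum principle for monotone semi-discrete transport equations on the
simplex: if `∂ₜφ + Σ_{(i,j)∈E} (√ω_{i,j}/h)(A_{i,j} D⁺φ + B_{i,j} D⁻φ) = 0` with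
`A_{i,j} ≤ 0 ≤ B_{i,j}`, then the spatial minimum of `φ` is non-decreasing, the spatial
maximum is non-increasing, and `‖φ(t)‖_∞ ≤ ‖φ(t₀)‖_∞` on `[t₀,T]`. -/
theorem discrete_maximum_principle (d : ℕ) (hd : 2 ≤ d)
    (ω : Fin d → Fin d → ℝ)
    (hsym : ∀ i j, ω i j = ω j i) (hdiag : ∀ i, ω i i = 0) (hnn : ∀ i j, 0 ≤ ω i j)
    (E : Finset (Fin d × Fin d)) (hE : ∀ p ∈ E, 0 < ω p.1 p.2)
    (ms : ℝ) (hms0 : 0 < ms) (hms1 : ms < 1 / d)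
    (t₀ T : ℝ) (ht₀T : t₀ < T)
    (A B : Fin d → Fin d → ℝ → (Fin d → ℝ) → ℝ)
    (hbdd : ∃ M : ℝ, ∀ i j : Fin d, ∀ t ∈ Icc t₀ T, ∀ ξ ∈ simplex d,
      |A i j t ξ| ≤ M ∧ |B i j t ξ| ≤ M)
    (hsign : ∀ p ∈ E, ∀ t ∈ Icc t₀ T, ∀ ξ ∈ simplex d,
      A p.1 p.2 t ξ ≤ 0 ∧ 0 ≤ B p.1 p.2 t ξ)
    (φ : ℝ → (Fin d → ℝ) → ℝ)
    (hφcont : ContinuousOn (fun z : ℝ × (Fin d → ℝ) => φ z.1 z.2)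
      (Icc t₀ T ×ˢ simplex d))
    (hφC1 : ∀ ξ ∈ simplex d,
      ContinuousOn (fun t => deriv (fun s => φ s ξ) t) (Icc t₀ T))
    (hPDE : ∀ t ∈ Ioc t₀ T, ∀ ξ ∈ simplex d,
      HasDerivAt (fun s => φ s ξ)
        (-(∑ p ∈ E, (Real.sqrt (ω p.1 p.2) / ms) *
            (A p.1 p.2 t ξ * Dplus d ms p.1 p.2 (φ t) ξ +
             B p.1 p.2 t ξ * Dminus d ms p.1 p.2 (φ t) ξ))) t) :
    MonotoneOn (fun t => sInf ((φ t) '' simplex d)) (Icc t₀ T) ∧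
    AntitoneOn (fun t => sSup ((φ t) '' simplex d)) (Icc t₀ T) ∧
    (∀ t ∈ Icc t₀ T, ∀ ξ ∈ simplex d,
      |φ t ξ| ≤ sSup ((fun η => |φ t₀ η|) '' simplex d)) := by
  have hlower : ∀ s ∈ Icc t₀ T, ∀ c : ℝ, (∀ ξ ∈ simplex d, c ≤ φ s ξ) →
      ∀ t ∈ Icc s T, ∀ ξ ∈ simplex d, c ≤ φ t ξ := by
    intro s hs c hc t ht ξ hξ
    exact le_of_monotone_scheme hms0.le
      (fun p hp t ht => hsign p hp t (Icc_subset_Icc_left hs.1 ht))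
      (hφcont.mono (prod_mono (Icc_subset_Icc_left hs.1) subset_rfl))
      (fun t ht => hPDE t (Ioc_subset_Ioc_left hs.1 ht)) hc ht hξ
  have hupper : ∀ s ∈ Icc t₀ T, ∀ c : ℝ, (∀ ξ ∈ simplex d, φ s ξ ≤ c) →
      ∀ t ∈ Icc s T, ∀ ξ ∈ simplex d, φ t ξ ≤ c := by
    intro s hs c hc t ht ξ hξ
    refine neg_le_neg_iff.1 (le_of_monotone_scheme (φ := fun t ξ => -φ t ξ) (ω := ω) hms0.le
      (fun p hp t ht => hsign p hp t (Icc_subset_Icc_left hs.1 ht))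
      (hφcont.mono (prod_mono (Icc_subset_Icc_left hs.1) subset_rfl)).neg
      (fun t ht ξ hξ => ?_) (fun ξ hξ => neg_le_neg (hc ξ hξ)) ht hξ)
    refine (hPDE t (Ioc_subset_Ioc_left hs.1 ht) ξ hξ).neg.congr_deriv (neg_inj.2 ?_)
    rw [← Finset.sum_neg_distrib]
    refine Finset.sum_congr rfl fun p _ => ?_
    rw [Dplus_neg, Dminus_neg]
    ring
  have hslice : ∀ t ∈ Icc t₀ T, ContinuousOn (φ t) (simplex d) := fun t ht =>
    hφcont.comp (f := fun ξ => (t, ξ)) (by fun_prop) fun ξ hξ => ⟨ht, hξ⟩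
  have hne := simplex_nonempty (d := d) (by omega)
  have hK := isCompact_simplex d
  refine ⟨fun s hs t ht hst => ?_, fun s hs t ht hst => ?_, fun t ht ξ hξ => ?_⟩
  · refine le_csInf (hne.image _) (forall_mem_image.2 (hlower s hs _ (fun ξ hξ => ?_) t
      ⟨hst, ht.2⟩))
    exact csInf_le (hK.bddBelow_image (hslice s hs)) (mem_image_of_mem _ hξ)
  · refine csSup_le (hne.image _) (forall_mem_image.2 (hupper s hs _ (fun ξ hξ => ?_) t
      ⟨hst, ht.2⟩))
    exact le_csSup (hK.bddAbove_image (hslice s hs)) (mem_image_of_mem _ hξ)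
  · have ht₀ : t₀ ∈ Icc t₀ T := left_mem_Icc.2 ht₀T.le
    have hinit : ∀ η ∈ simplex d, |φ t₀ η| ≤ sSup ((fun η => |φ t₀ η|) '' simplex d) :=
      fun η hη => le_csSup (hK.bddAbove_image (hslice t₀ ht₀).abs)
        (mem_image_of_mem (fun η => |φ t₀ η|) hη)
    exact abs_le.2 ⟨hlower t₀ ht₀ _ (fun η hη => (abs_le.1 (hinit η hη)).1) t ht ξ hξ,
      hupper t₀ ht₀ _ (fun η hη => (abs_le.1 (hinit η hη)).2) t ht ξ hξ⟩
end
end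

section
/- Let P(G) = {ξ ∈ [0,1]^d : Σᵢ ξᵢ = 1}, h ∈ (0,1/d), and let A_{i,j}, B_{i,j} : P(G) → ℝ be bounded measurable for each (i,j) ∈ E; define L_h on bounded measurable functions by L_h f(ξ) = Σ_{(i,j)∈E} (√ω_{i,j}/h) (A_{i,j}(ξ) D⁺_{e_{i,j}}f(ξ) + B_{i,j}(ξ) D⁻_{e_{i,j}}f(ξ)), with the constant-extrapolation convention. Suppose ρ, ρ̃ ∈ C¹([0,T]; M(P(G))) both satisfy the weak formulation d/dt ∫_{P(G)} φ dρ(t) = ∫_{P(G)} L_h φ dρ(t) for every bounded measurable φ : P(G) → ℝ and every t ∈ [0,T), and ρ(T) = ρ̃(T). Then ρ(t) = ρ̃(t) for all t ∈ [0,T]. -/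
open Set MeasureTheory

attribute [local instance] Classical.propDecidable

noncomputable section

/-- The interior of the probability simplex. -/
def simplexInt (d : ℕ) : Set (Fin d → ℝ) :=
  {ξ | (∀ i, 0 < ξ i ∧ ξ i < 1) ∧ ∑ i, ξ i = 1}

/-- The discrete transport operator
`L_h f(ξ) = Σ_{(i,j)∈E} (√ω_{i,j}/h)(A_{i,j}(ξ) D⁺f(ξ) + B_{i,j}(ξ) D⁻f(ξ))`. -/
def Lh (d : ℕ) (ω : Fin d → Fin d → ℝ) (E : Finset (Fin d × Fin d)) (ms : ℝ)
    (A B : Fin d → Fin d → (Fin d → ℝ) → ℝ)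
    (f : (Fin d → ℝ) → ℝ) (ξ : Fin d → ℝ) : ℝ :=
  ∑ p ∈ E, (Real.sqrt (ω p.1 p.2) / ms) *
    (A p.1 p.2 ξ * Dplus d ms p.1 p.2 f ξ + B p.1 p.2 ξ * Dminus d ms p.1 p.2 f ξ)

/-- Integral of a function against a finite signed measure (via its Jordan decomposition). -/
def sInt {X : Type*} [MeasurableSpace X] (μ : SignedMeasure X) (f : X → ℝ) : ℝ :=
  (∫ x, f x ∂μ.toJordanDecomposition.posPart) -
    ∫ x, f x ∂μ.toJordanDecomposition.negPart

/-- Total variation norm of a finite signed measure. -/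
def tvNorm {X : Type*} [MeasurableSpace X] (μ : SignedMeasure X) : ℝ :=
  (μ.totalVariation Set.univ).toReal

/-- `ρ ∈ C¹([0,T]; M(X))`: `ρ` is continuously differentiable on `[0,T]` as a curve in
the Banach space of finite signed Radon measures with the total variation norm. -/
def TVC1 {X : Type*} [MeasurableSpace X] (ρ : ℝ → SignedMeasure X) (T : ℝ) : Prop :=
  ∃ ρ' : ℝ → SignedMeasure X,
    (∀ t ∈ Icc (0:ℝ) T, Filter.Tendsto (fun s => tvNorm (ρ s - ρ t))
      (nhdsWithin t (Icc (0:ℝ) T)) (nhds 0)) ∧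
    (∀ t ∈ Icc (0:ℝ) T, Filter.Tendsto (fun s => tvNorm (ρ' s - ρ' t))
      (nhdsWithin t (Icc (0:ℝ) T)) (nhds 0)) ∧
    (∀ t ∈ Icc (0:ℝ) T, Filter.Tendsto
      (fun s => tvNorm ((s - t)⁻¹ • (ρ s - ρ t) - ρ' t))
      (nhdsWithin t (Icc (0:ℝ) T \ {t})) (nhds 0))

theorem integrable_of_abs_le {X : Type*} [MeasurableSpace X] (μ : Measure X) [IsFiniteMeasure μ]
    {φ : X → ℝ} (hφ : Measurable φ) {m : ℝ} (hm : ∀ x, |φ x| ≤ m) : Integrable φ μ :=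
  Integrable.of_bound hφ.aestronglyMeasurable m (Filter.Eventually.of_forall hm)

/-- `sInt` is additive in the measure on bounded measurable functions. -/
theorem sInt_sub {X : Type*} [MeasurableSpace X] (μ ν : SignedMeasure X)
    {φ : X → ℝ} (hφ : Measurable φ) {m : ℝ} (hm : ∀ x, |φ x| ≤ m) :
    sInt (μ - ν) φ = sInt μ φ - sInt ν φ := by
  have key : (μ - ν).toJordanDecomposition.posPart +
        (μ.toJordanDecomposition.negPart + ν.toJordanDecomposition.posPart) =
      (μ - ν).toJordanDecomposition.negPart +
        (μ.toJordanDecomposition.posPart + ν.toJordanDecomposition.negPart) := by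
    ext S hS
    have h : (μ - ν) S = μ S - ν S := rfl
    rw [SignedMeasure.apply_eq_posPart_real_sub_negPart_real _ hS,
      SignedMeasure.apply_eq_posPart_real_sub_negPart_real μ hS,
      SignedMeasure.apply_eq_posPart_real_sub_negPart_real ν hS] at h
    rw [← measureReal_eq_measureReal_iff, measureReal_add_apply, measureReal_add_apply,
      measureReal_add_apply, measureReal_add_apply]
    linarith
  have hi := fun (κ : Measure X) [IsFiniteMeasure κ] => integrable_of_abs_le κ hφ hm
  have h := congrArg (fun κ : Measure X => ∫ x, φ x ∂κ) key
  rw [integral_add_measure (hi _) (hi _), integral_add_measure (hi _) (hi _),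
    integral_add_measure (hi _) (hi _), integral_add_measure (hi _) (hi _)] at h
  unfold sInt
  linarith

theorem abs_sInt_le {X : Type*} [MeasurableSpace X] (μ : SignedMeasure X)
    {φ : X → ℝ} {m : ℝ} (hm : ∀ x, |φ x| ≤ m) :
    |sInt μ φ| ≤ m * tvNorm μ := by
  have h := fun (κ : Measure X) [IsFiniteMeasure κ] =>
    norm_integral_le_of_norm_le_const (μ := κ) (f := φ) (C := m) (Filter.Eventually.of_forall hm)
  have h1 := h μ.toJordanDecomposition.posPart
  have h2 := h μ.toJordanDecomposition.negPart
  have h3 : tvNorm μ = μ.toJordanDecomposition.posPart.real univ +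
      μ.toJordanDecomposition.negPart.real univ :=
    measureReal_add_apply
  rw [h3, mul_add]
  exact (abs_sub _ _).trans (add_le_add h1 h2)

theorem sInt_indicator_one {X : Type*} [MeasurableSpace X] (μ : SignedMeasure X)
    {S : Set X} (hS : MeasurableSet S) : sInt μ (S.indicator 1) = μ S := by
  rw [SignedMeasure.apply_eq_posPart_real_sub_negPart_real μ hS, sInt,
    integral_indicator_one hS, integral_indicator_one hS]

/-- Only the values on a set carrying the measure matter for `sInt`. -/
theorem sInt_indicator_of_totalVariation_compl {X : Type*} [MeasurableSpace X]
    (μ : SignedMeasure X) {S : Set X} (hS : μ.totalVariation Sᶜ = 0) (φ : X → ℝ) :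
    sInt μ (S.indicator φ) = sInt μ φ := by
  have hS' : μ.toJordanDecomposition.posPart Sᶜ + μ.toJordanDecomposition.negPart Sᶜ = 0 := hS
  rw [add_eq_zero] at hS'
  have h : ∀ κ : Measure X, κ Sᶜ = 0 → ∫ x, S.indicator φ x ∂κ = ∫ x, φ x ∂κ := by
    intro κ hκ
    refine integral_congr_ae ?_
    filter_upwards [mem_ae_iff.2 hκ] with x hx
    exact indicator_of_mem hx φ
  rw [sInt, sInt, h _ hS'.1, h _ hS'.2]

theorem continuousOn_sInt {X : Type*} [MeasurableSpace X] {ρ : ℝ → SignedMeasure X} {T : ℝ}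
    (hρ : TVC1 ρ T) {φ : X → ℝ} (hφ : Measurable φ) {m : ℝ} (hm : ∀ x, |φ x| ≤ m) :
    ContinuousOn (fun s => sInt (ρ s) φ) (Icc 0 T) := by
  obtain ⟨_, hc, -, -⟩ := hρ
  intro t ht
  refine tendsto_iff_norm_sub_tendsto_zero.2 ?_
  refine squeeze_zero (fun _ => norm_nonneg _) (fun s => ?_)
    (by simpa using (hc t ht).const_mul m)
  rw [← sInt_sub _ _ hφ hm]
  exact abs_sInt_le _ hm

theorem exists_bound_sInt {X : Type*} [MeasurableSpace X] {ρ : ℝ → SignedMeasure X} {T : ℝ}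
    (hρ : TVC1 ρ T) :
    ∃ K : ℝ, ∀ t ∈ Icc (0 : ℝ) T, ∀ φ : X → ℝ, Measurable φ → ∀ m : ℝ, 0 ≤ m →
      (∀ x, |φ x| ≤ m) → |sInt (ρ t) φ| ≤ m * K := by
  obtain ⟨_, hc, -, -⟩ := hρ
  refine isCompact_Icc.induction_on (p := fun s => ∃ K : ℝ, ∀ t ∈ s, ∀ φ : X → ℝ,
    Measurable φ → ∀ m : ℝ, 0 ≤ m → (∀ x, |φ x| ≤ m) → |sInt (ρ t) φ| ≤ m * K) ?_ ?_ ?_ ?_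
  · exact ⟨0, by simp⟩
  · rintro s t hst ⟨K, hK⟩
    exact ⟨K, fun r hr => hK r (hst hr)⟩
  · rintro s t ⟨K, hK⟩ ⟨K', hK'⟩
    refine ⟨max K K', fun r hr φ hφ m hm0 hm => ?_⟩
    rcases hr with hr | hr
    · exact (hK r hr φ hφ m hm0 hm).trans (by gcongr; exact le_max_left _ _)
    · exact (hK' r hr φ hφ m hm0 hm).trans (by gcongr; exact le_max_right _ _)
  · intro t ht
    refine ⟨_, (hc t ht).eventually (eventually_lt_nhds zero_lt_one), tvNorm (ρ t) + 1,
      fun s hs φ hφ m hm0 hm => ?_⟩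
    have hs : tvNorm (ρ s - ρ t) < 1 := hs
    have h1 := abs_sInt_le (ρ s - ρ t) hm
    have h2 := abs_sInt_le (ρ t) hm
    rw [sInt_sub _ _ hφ hm] at h1
    have h3 : m * tvNorm (ρ s - ρ t) ≤ m * 1 := by gcongr
    have h4 := abs_sub_abs_le_abs_sub (sInt (ρ s) φ) (sInt (ρ t) φ)
    linarith

theorem measurableSet_simplex (d : ℕ) : MeasurableSet (simplex d) := by
  have : simplex d = (⋂ i, {ξ : Fin d → ℝ | 0 ≤ ξ i ∧ ξ i ≤ 1}) ∩ {ξ | ∑ i, ξ i = 1} := by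
    ext ξ
    simp [simplex]
  rw [this]
  refine MeasurableSet.inter (MeasurableSet.iInter fun i => ?_) ?_
  · exact (measurableSet_le measurable_const (measurable_pi_apply i)).inter
      (measurableSet_le (measurable_pi_apply i) measurable_const)
  · exact measurableSet_eq_fun (by fun_prop) measurable_const

theorem measurable_Dplus (d : ℕ) (ms : ℝ) (i j : Fin d) {u : (Fin d → ℝ) → ℝ}
    (hu : Measurable u) : Measurable (Dplus d ms i j u) := by
  have h : Measurable fun ξ : Fin d → ℝ => ξ + ms • eVec d i j := measurable_id.add_const _
  exact Measurable.ite (h (measurableSet_simplex d)) ((hu.comp h).sub hu) measurable_const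

theorem measurable_Dminus (d : ℕ) (ms : ℝ) (i j : Fin d) {u : (Fin d → ℝ) → ℝ}
    (hu : Measurable u) : Measurable (Dminus d ms i j u) := by
  have h : Measurable fun ξ : Fin d → ℝ => ξ - ms • eVec d i j := measurable_id.sub_const _
  exact Measurable.ite (h (measurableSet_simplex d)) (hu.sub (hu.comp h)) measurable_const

theorem measurable_Lh (d : ℕ) (ω : Fin d → Fin d → ℝ) (E : Finset (Fin d × Fin d)) (ms : ℝ)
    {A B : Fin d → Fin d → (Fin d → ℝ) → ℝ}
    (hAB : ∀ i j : Fin d, Measurable (A i j) ∧ Measurable (B i j))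
    {u : (Fin d → ℝ) → ℝ} (hu : Measurable u) : Measurable (Lh d ω E ms A B u) := by
  refine Finset.measurable_fun_sum _ fun p _ => Measurable.const_mul ?_ _
  exact ((hAB _ _).1.mul (measurable_Dplus d ms _ _ hu)).add
    ((hAB _ _).2.mul (measurable_Dminus d ms _ _ hu))

theorem abs_Dplus_le (d : ℕ) (ms : ℝ) (i j : Fin d) {u : (Fin d → ℝ) → ℝ} {m : ℝ} (hm0 : 0 ≤ m)
    (hm : ∀ ξ, |u ξ| ≤ m) (ξ : Fin d → ℝ) : |Dplus d ms i j u ξ| ≤ 2 * m := by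
  unfold Dplus
  split_ifs
  · have := abs_sub (u (ξ + ms • eVec d i j)) (u ξ)
    linarith [hm ξ, hm (ξ + ms • eVec d i j)]
  · simpa using hm0

theorem abs_Dminus_le (d : ℕ) (ms : ℝ) (i j : Fin d) {u : (Fin d → ℝ) → ℝ} {m : ℝ} (hm0 : 0 ≤ m)
    (hm : ∀ ξ, |u ξ| ≤ m) (ξ : Fin d → ℝ) : |Dminus d ms i j u ξ| ≤ 2 * m := by
  unfold Dminus
  split_ifs
  · have := abs_sub (u ξ) (u (ξ - ms • eVec d i j))
    linarith [hm ξ, hm (ξ - ms • eVec d i j)]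
  · simpa using hm0

/-- `L_h` is a bounded operator on bounded functions over the simplex. -/
theorem exists_bound_Lh (d : ℕ) (ω : Fin d → Fin d → ℝ) (E : Finset (Fin d × Fin d)) {ms : ℝ}
    (hms : 0 < ms) {A B : Fin d → Fin d → (Fin d → ℝ) → ℝ}
    (hAB : ∃ M : ℝ, ∀ i j : Fin d, ∀ ξ ∈ simplex d, |A i j ξ| ≤ M ∧ |B i j ξ| ≤ M) :
    ∃ C : ℝ, 0 ≤ C ∧ ∀ (u : (Fin d → ℝ) → ℝ) (m : ℝ), 0 ≤ m → (∀ ξ, |u ξ| ≤ m) →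
      ∀ ξ, |(simplex d).indicator (Lh d ω E ms A B u) ξ| ≤ C * m := by
  obtain ⟨M, hM⟩ := hAB
  have hC : 0 ≤ ∑ p ∈ E, Real.sqrt (ω p.1 p.2) / ms * (4 * max M 0) :=
    Finset.sum_nonneg fun p _ => by positivity
  refine ⟨_, hC, fun u m hm0 hm ξ => ?_⟩
  by_cases hξ : ξ ∈ simplex d
  · rw [indicator_of_mem hξ, Lh, Finset.sum_mul]
    refine (Finset.abs_sum_le_sum_abs _ _).trans (Finset.sum_le_sum fun p _ => ?_)
    have hs : 0 ≤ Real.sqrt (ω p.1 p.2) / ms := by positivity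
    rw [abs_mul, abs_of_nonneg hs, mul_assoc]
    refine mul_le_mul_of_nonneg_left ((abs_add_le _ _).trans ?_) hs
    rw [abs_mul, abs_mul]
    have hA := (hM p.1 p.2 ξ hξ).1.trans (le_max_left M 0)
    have hB := (hM p.1 p.2 ξ hξ).2.trans (le_max_left M 0)
    have h1 := mul_le_mul hA (abs_Dplus_le d ms p.1 p.2 hm0 hm ξ) (abs_nonneg _)
      (le_max_right M 0)
    have h2 := mul_le_mul hB (abs_Dminus_le d ms p.1 p.2 hm0 hm ξ) (abs_nonneg _)
      (le_max_right M 0)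
    linarith
  · rw [indicator_of_notMem hξ, abs_zero]
    positivity

/-- Backward comparison with an exponential for a function vanishing at the right endpoint. -/
theorem le_mul_exp_of_neg_deriv_le {T D c : ℝ} (hD : 0 ≤ D) {f f' : ℝ → ℝ}
    (hf : ContinuousOn f (Icc 0 T)) (hf' : ∀ t ∈ Ioo 0 T, HasDerivAt f (f' t) t)
    (hb : ∀ t ∈ Ioo 0 T, -f' t ≤ D * c * Real.exp (c * (T - t))) (hT : f T = 0)
    {t : ℝ} (ht : t ∈ Icc 0 T) : f t ≤ D * Real.exp (c * (T - t)) := by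
  have hmono : MonotoneOn (fun s => f s - D * Real.exp (c * (T - s))) (Icc 0 T) := by
    refine monotoneOn_of_hasDerivWithinAt_nonneg (convex_Icc 0 T)
      (f' := fun s => f' s - D * (Real.exp (c * (T - s)) * (c * (0 - 1))))
      (hf.sub (by fun_prop)) ?_ ?_
    · intro s hs
      rw [interior_Icc] at hs
      exact ((hf' s hs).sub ((((hasDerivAt_const s T).sub (hasDerivAt_id s)).const_mul
        c).exp.const_mul D)).hasDerivWithinAt
    · intro s hs
      rw [interior_Icc] at hs
      linarith [hb s hs]
  have h := hmono ht (right_mem_Icc.2 (ht.1.trans ht.2)) ht.2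
  simp only [hT, sub_self, mul_zero, Real.exp_zero] at h
  linarith

theorem abs_le_mul_exp_of_abs_deriv_le {T D c : ℝ} (hD : 0 ≤ D) {f f' : ℝ → ℝ}
    (hf : ContinuousOn f (Icc 0 T)) (hf' : ∀ t ∈ Ioo 0 T, HasDerivAt f (f' t) t)
    (hb : ∀ t ∈ Ioo 0 T, |f' t| ≤ D * c * Real.exp (c * (T - t))) (hT : f T = 0)
    {t : ℝ} (ht : t ∈ Icc 0 T) : |f t| ≤ D * Real.exp (c * (T - t)) := by
  refine abs_le'.2 ⟨le_mul_exp_of_neg_deriv_le hD hf hf'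
    (fun s hs => (neg_le_abs _).trans (hb s hs)) hT ht, ?_⟩
  exact le_mul_exp_of_neg_deriv_le hD hf.neg (fun s hs => (hf' s hs).neg)
    (fun s hs => by simpa using (le_abs_self _).trans (hb s hs)) (by simpa using hT) ht

/-- Uniqueness of the measure-valued weighted adjoint variable: two `C¹` (in total
variation) curves of finite signed Radon measures satisfying the same weak formulation
`d/dt ∫ φ dρ(t) = ∫ L_h φ dρ(t)` for every bounded measurable `φ`, with the same terminal
value at `t = T`, coincide on `[0,T]`. -/
theorem adjoint_uniqueness (d : ℕ) (hd : 2 ≤ d)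
    (ω : Fin d → Fin d → ℝ)
    (hsym : ∀ i j, ω i j = ω j i) (hdiag : ∀ i, ω i i = 0) (hnn : ∀ i j, 0 ≤ ω i j)
    (E : Finset (Fin d × Fin d)) (hE : ∀ p ∈ E, 0 < ω p.1 p.2)
    (ms : ℝ) (hms0 : 0 < ms) (hms1 : ms < 1 / d)
    (T : ℝ) (hT : 0 < T)
    (A B : Fin d → Fin d → (Fin d → ℝ) → ℝ)
    (hABm : ∀ i j : Fin d, Measurable (A i j) ∧ Measurable (B i j))
    (hABb : ∃ M : ℝ, ∀ i j : Fin d, ∀ ξ ∈ simplex d, |A i j ξ| ≤ M ∧ |B i j ξ| ≤ M)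
    (ρ ρ' : ℝ → SignedMeasure (Fin d → ℝ))
    (hρC1 : TVC1 ρ T) (hρ'C1 : TVC1 ρ' T)
    (hsupp : ∀ t ∈ Icc (0:ℝ) T, (ρ t).totalVariation (simplex d)ᶜ = 0)
    (hsupp' : ∀ t ∈ Icc (0:ℝ) T, (ρ' t).totalVariation (simplex d)ᶜ = 0)
    (hweak : ∀ φ : (Fin d → ℝ) → ℝ, Measurable φ → (∃ M : ℝ, ∀ ξ, |φ ξ| ≤ M) →
      ∀ t ∈ Ico (0:ℝ) T,
        HasDerivWithinAt (fun s => sInt (ρ s) φ)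
          (sInt (ρ t) (Lh d ω E ms A B φ)) (Icc (0:ℝ) T) t)
    (hweak' : ∀ φ : (Fin d → ℝ) → ℝ, Measurable φ → (∃ M : ℝ, ∀ ξ, |φ ξ| ≤ M) →
      ∀ t ∈ Ico (0:ℝ) T,
        HasDerivWithinAt (fun s => sInt (ρ' s) φ)
          (sInt (ρ' t) (Lh d ω E ms A B φ)) (Icc (0:ℝ) T) t)
    (hterm : ρ T = ρ' T) :
    ∀ t ∈ Icc (0:ℝ) T, ρ t = ρ' t := by
  obtain ⟨C, hC0, hC⟩ := exists_bound_Lh d ω E hms0 hABb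
  obtain ⟨K, hK⟩ := exists_bound_sInt hρC1
  obtain ⟨K', hK'⟩ := exists_bound_sInt hρ'C1
  have hKK : 0 ≤ K + K' := by
    have h := hK T (right_mem_Icc.2 hT.le) (fun _ => 0) measurable_const 1 zero_le_one (by simp)
    have h' := hK' T (right_mem_Icc.2 hT.le) (fun _ => 0) measurable_const 1 zero_le_one (by simp)
    linarith [(abs_nonneg _).trans h, (abs_nonneg _).trans h']
  have bound : ∀ n : ℕ, ∀ φ : (Fin d → ℝ) → ℝ, Measurable φ → ∀ m : ℝ, 0 ≤ m →
      (∀ ξ, |φ ξ| ≤ m) → ∀ t ∈ Icc (0 : ℝ) T,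
        |sInt (ρ t) φ - sInt (ρ' t) φ| ≤
          m * ((K + K') * (1 / 2) ^ n) * Real.exp (2 * C * (T - t)) := by
    intro n
    induction n with
    | zero =>
      intro φ hφ m hm0 hm t ht
      have h := hK t ht φ hφ m hm0 hm
      have h' := hK' t ht φ hφ m hm0 hm
      have he : 1 ≤ Real.exp (2 * C * (T - t)) :=
        Real.one_le_exp (mul_nonneg (by positivity) (sub_nonneg.2 ht.2))
      calc _ ≤ m * K + m * K' := (abs_sub _ _).trans (add_le_add h h')
        _ = m * ((K + K') * (1 / 2) ^ 0) := by ring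
        _ ≤ _ := le_mul_of_one_le_right (by positivity) he
    | succ n ih =>
      intro φ hφ m hm0 hm t ht
      refine abs_le_mul_exp_of_abs_deriv_le (by positivity)
        ((continuousOn_sInt hρC1 hφ hm).sub (continuousOn_sInt hρ'C1 hφ hm))
        (f' := fun s => sInt (ρ s) (Lh d ω E ms A B φ) - sInt (ρ' s) (Lh d ω E ms A B φ))
        (fun s hs => ?_) (fun s hs => ?_) (by simp [hterm]) ht
      · have hn := Icc_mem_nhds hs.1 hs.2
        exact ((hweak φ hφ ⟨m, hm⟩ s ⟨hs.1.le, hs.2⟩).hasDerivAt hn).sub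
          ((hweak' φ hφ ⟨m, hm⟩ s ⟨hs.1.le, hs.2⟩).hasDerivAt hn)
      · have hs' := Ioo_subset_Icc_self hs
        rw [← sInt_indicator_of_totalVariation_compl _ (hsupp s hs'),
          ← sInt_indicator_of_totalVariation_compl _ (hsupp' s hs')]
        refine (ih _ ((measurable_Lh d ω E ms hABm hφ).indicator (measurableSet_simplex d))
          (C * m) (by positivity) (hC φ m hm0 hm) s hs').trans_eq ?_
        ring
  intro t ht
  ext S hS
  have hS1 : ∀ ξ, |S.indicator (1 : (Fin d → ℝ) → ℝ) ξ| ≤ 1 := fun ξ => by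
    by_cases h : ξ ∈ S <;> simp [h]
  rw [← sInt_indicator_one _ hS, ← sInt_indicator_one _ hS, ← sub_eq_zero, ← abs_nonpos_iff]
  refine ge_of_tendsto' (x := Filter.atTop) ?_ fun n =>
    bound n _ (measurable_one.indicator hS) 1 zero_le_one hS1 t ht
  have h := tendsto_pow_atTop_nhds_zero_of_lt_one (r := (1 / 2 : ℝ)) (by norm_num) (by norm_num)
  simpa using ((h.const_mul (K + K')).const_mul 1).mul_const (Real.exp (2 * C * (T - t)))
end
end
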